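/- Let n ≥ 5, let (k,ℓ) be an arc of the complete directed graph on {1,…,n}, and let C = (c_{ij}) be a linear cost matrix. Then C satisfies the (k,ℓ)-constant value property (all tours containing the arc (k,ℓ) have the same cost) if and only if there exist reals a_i for i ∈ {1,…,n}∖{k} and b_j for j ∈ {1,…,n}∖{ℓ} such that c_{ij} = a_i + b_j for all arcs (i,j) with i ≠ k, j ≠ ℓ and (i,j) ≠ (ℓ,k). Moreover, in this case the common cost of every tour containing (k,ℓ) equals c_{kℓ} + Σ_{i ≠ k} a_i + Σ_{j ≠ ℓ} b_j. -/

import Mathlib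

open Finset

/-- A tour (Hamiltonian cycle) on the complete directed graph on `Fin n`,
identified with a cyclic permutation whose unique cycle has length `n`. -/
def IsTour {n : ℕ} (σ : Equiv.Perm (Fin n)) : Prop :=
  σ.IsCycle ∧ σ.support = Finset.univ

/-- The cost of a tour `σ` with respect to a linear cost matrix `C`. -/
def linCost {n : ℕ} (C : Fin n → Fin n → ℝ) (σ : Equiv.Perm (Fin n)) : ℝ :=
  ∑ i, C i (σ i)

/-- The quadratic cost of a tour `σ` with respect to a quadratic cost matrix `Q`. -/
def quadCost {n : ℕ} (Q : Fin n × Fin n → Fin n × Fin n → ℝ) (σ : Equiv.Perm (Fin n)) : ℝ :=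
  ∑ i, ∑ j, Q (i, σ i) (j, σ j)

/-- `Q` is linearizable if some linear cost matrix `C` satisfies `Q[τ] = C(τ)` for all tours. -/
def Linearizable {n : ℕ} (Q : Fin n × Fin n → Fin n × Fin n → ℝ) : Prop :=
  ∃ C : Fin n → Fin n → ℝ, ∀ σ : Equiv.Perm (Fin n), IsTour σ → quadCost Q σ = linCost C σ

/-- The cyclic permutation of a duplicate-free list moves every entry to the next one. -/
lemma List.map_formPerm_eq_rotate {α : Type*} [DecidableEq α] (L : List α) (hL : L.Nodup) :
    L.map L.formPerm = L.rotate 1 := by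
  apply List.ext_getElem
  · simp
  · intro i h₁ h₂
    simp [List.formPerm_apply_getElem L hL, List.getElem_rotate]

lemma List.formPerm_apply_of_consecutive {α : Type*} [DecidableEq α] (A B : List α) (k l : α)
    (hL : (A ++ k :: l :: B).Nodup) : (A ++ k :: l :: B).formPerm k = l := by
  have h := List.formPerm_apply_lt_getElem _ hL A.length (by simp)
  simpa using h

lemma isTour_formPerm {n : ℕ} (hn : 2 ≤ n) (L : List (Fin n)) (hL : L.Nodup)
    (hmem : ∀ v, v ∈ L) : IsTour L.formPerm := by
  have huniv : L.toFinset = univ := by ext v; simp [hmem v]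
  have hlen : L.length = n := by
    rw [← List.toFinset_card_of_nodup hL, huniv, card_univ, Fintype.card_fin]
  refine ⟨List.isCycle_formPerm hL (by omega), ?_⟩
  rw [List.support_formPerm_of_nodup L hL, huniv]
  rintro v rfl
  simp only [List.length_singleton] at hlen
  omega

lemma linCost_formPerm {n : ℕ} (C : Fin n → Fin n → ℝ) (L : List (Fin n)) (hL : L.Nodup)
    (hmem : ∀ v, v ∈ L) : linCost C L.formPerm = (List.zipWith C L (L.rotate 1)).sum := by
  have huniv : L.toFinset = univ := by ext v; simp [hmem v]
  rw [linCost, ← huniv, List.sum_toFinset _ hL, ← List.map_formPerm_eq_rotate L hL,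
    List.zipWith_map_right, List.zipWith_self]

/-- The contribution of a fixed segment `R ++ [x]` to the cost of a cyclic list splits off. -/
lemma List.exists_sum_zipWith_rotate {α : Type*} (C : α → α → ℝ) (R : List α) (x : α) :
    ∃ (W : ℝ) (r : α), ∀ t : List α,
      (List.zipWith C (R ++ x :: t) ((R ++ x :: t).rotate 1)).sum =
        W + (List.zipWith C (x :: t) (t ++ [r])).sum := by
  cases R with
  | nil => exact ⟨0, x, fun t => by simp⟩
  | cons r R =>
    refine ⟨(List.zipWith C (r :: R) (R ++ [x])).sum, r, fun t => ?_⟩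
    have h : ((r :: R) ++ x :: t).rotate 1 = (R ++ [x]) ++ (t ++ [r]) := by simp
    rw [h, List.zipWith_append (by simp), List.sum_append]

lemma IsTour.inv {n : ℕ} {σ : Equiv.Perm (Fin n)} (h : IsTour σ) : IsTour σ⁻¹ :=
  ⟨h.1.inv, by rw [Equiv.Perm.support_inv, h.2]⟩

lemma linCost_inv {n : ℕ} (C : Fin n → Fin n → ℝ) (σ : Equiv.Perm (Fin n)) :
    linCost C σ⁻¹ = linCost (fun i j => C j i) σ := by
  unfold linCost
  rw [← Equiv.sum_comp σ]
  simp

/-- Under the `(k,l)`-constant value property, the sources `l` and `x` can be exchanged. -/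
lemma exchange_source {n : ℕ} (C : Fin n → Fin n → ℝ) (k l : Fin n) (hkl : k ≠ l) (K : ℝ)
    (hK : ∀ σ : Equiv.Perm (Fin n), IsTour σ → σ k = l → linCost C σ = K)
    (x y z : Fin n) (hxy : x ≠ y) (hxz : x ≠ z) (hyz : y ≠ z)
    (hxk : x ≠ k) (hxl : x ≠ l) (hyk : y ≠ k) (hyl : y ≠ l) (hzk : z ≠ k) (hzl : z ≠ l) :
    C l y + C x z = C l z + C x y := by
  set S : Finset (Fin n) := {k, l, x, y, z} with hS
  set R : List (Fin n) := (univ \ S).toList with hR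
  have hRnodup : R.Nodup := Finset.nodup_toList _
  have hRmem : ∀ v, v ∈ R ↔ ¬ (v = k ∨ v = l ∨ v = x ∨ v = y ∨ v = z) := by
    intro v; simp [hR, hS]
  have hn : 2 ≤ n := by
    have := k.isLt
    have := l.isLt
    have := Fin.val_ne_of_ne hkl
    omega
  obtain ⟨W, r, hW⟩ := List.exists_sum_zipWith_rotate C R x
  have key : ∀ A B : List (Fin n), List.Perm (A ++ k :: l :: B) [y, z, k, l] →
      W + (List.zipWith C (x :: (A ++ k :: l :: B)) ((A ++ k :: l :: B) ++ [r])).sum = K := by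
    intro A B hperm
    have hp : List.Perm (R ++ x :: (A ++ k :: l :: B)) (R ++ [x, y, z, k, l]) :=
      (hperm.cons x).append_left R
    have hnd : (R ++ x :: (A ++ k :: l :: B)).Nodup := by
      rw [hp.nodup_iff, List.nodup_append]
      refine ⟨hRnodup, by simp [*], ?_⟩
      intro v hv w hw
      rw [hRmem] at hv
      simp only [List.mem_cons, List.not_mem_nil, or_false] at hw
      rintro rfl
      tauto
    have hmem : ∀ v, v ∈ R ++ x :: (A ++ k :: l :: B) := by
      intro v
      rw [hp.mem_iff, List.mem_append, hRmem]
      simp only [List.mem_cons, List.not_mem_nil, or_false]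
      tauto
    rw [← hW, ← linCost_formPerm C _ hnd hmem]
    refine hK _ (isTour_formPerm hn _ hnd hmem) ?_
    have := List.formPerm_apply_of_consecutive (R ++ x :: A) B k l (by simpa using hnd)
    simpa using this
  have h₁ := key [y, z] [] (List.Perm.refl _)
  have h₂ := key [z, y] [] (List.Perm.swap y z _)
  have h₃ := key [y] [z] (by grind)
  have h₄ := key [z] [y] (by grind)
  have h₅ := key [] [y, z] (by grind)
  have h₆ := key [] [z, y] (by grind)
  simp only [List.nil_append, List.cons_append, List.zipWith_cons_cons, List.zipWith_nil_left,
    List.sum_cons, List.sum_nil] at h₁ h₂ h₃ h₄ h₅ h₆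
  linarith

/-- Under the `(k,l)`-constant value property, the targets `k` and `x` can be exchanged. -/
lemma exchange_target {n : ℕ} (C : Fin n → Fin n → ℝ) (k l : Fin n) (hkl : k ≠ l) (K : ℝ)
    (hK : ∀ σ : Equiv.Perm (Fin n), IsTour σ → σ k = l → linCost C σ = K)
    (x y z : Fin n) (hxy : x ≠ y) (hxz : x ≠ z) (hyz : y ≠ z)
    (hxk : x ≠ k) (hxl : x ≠ l) (hyk : y ≠ k) (hyl : y ≠ l) (hzk : z ≠ k) (hzl : z ≠ l) :
    C y k + C z x = C z k + C y x := by
  refine exchange_source (fun i j => C j i) l k hkl.symm K (fun σ hσ h => ?_) x y z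
    hxy hxz hyz hxl hxk hyl hyk hzl hzk
  rw [← linCost_inv]
  exact hK _ hσ.inv (by rw [Equiv.Perm.inv_eq_iff_eq, h])

lemma exists_ne_of_four {n : ℕ} (hn : 5 ≤ n) (p q r s : Fin n) :
    ∃ v : Fin n, v ≠ p ∧ v ≠ q ∧ v ≠ r ∧ v ≠ s := by
  have hcard : #({p, q, r, s} : Finset (Fin n)) < #(univ : Finset (Fin n)) := by
    have := Finset.card_le_four (a := p) (b := q) (c := r) (d := s)
    rw [card_univ, Fintype.card_fin]
    omega
  obtain ⟨v, -, hv⟩ := Finset.exists_mem_notMem_of_card_lt_card hcard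
  exact ⟨v, by simpa using hv⟩

lemma exists_weak_sum_of_constant {n : ℕ} (hn : 5 ≤ n) (k l : Fin n) (hkl : k ≠ l)
    (C : Fin n → Fin n → ℝ) (K : ℝ)
    (hK : ∀ σ : Equiv.Perm (Fin n), IsTour σ → σ k = l → linCost C σ = K) :
    ∃ a b : Fin n → ℝ, ∀ i j : Fin n, i ≠ j → i ≠ k → j ≠ l → (i, j) ≠ (l, k) →
      C i j = a i + b j := by
  have hs := exchange_source C k l hkl K hK
  have ht := exchange_target C k l hkl K hK
  obtain ⟨p, hpk, hpl, -, -⟩ := exists_ne_of_four hn k l k l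
  obtain ⟨q, hqk, hql, hqp, -⟩ := exists_ne_of_four hn k l p p
  obtain ⟨r, hrk, hrl, hrp, hrq⟩ := exists_ne_of_four hn k l p q
  refine ⟨fun i => if i = l then 0 else if i = p then C p q - C l q else C i p - C l p,
    fun j => if j = k then C p k - (C p q - C l q) else C l j, fun i j hij hik hjl hlk => ?_⟩
  dsimp only
  by_cases hil : i = l
  · subst hil
    have hjk : j ≠ k := fun h => hlk (by rw [h])
    simp [hjk]
  by_cases hjk : j = k
  · subst hjk
    by_cases hip : i = p
    · subst hip
      simp [hil]
    by_cases hiq : i = q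
    · subst hiq
      have h₁ := ht r i p hrq hrp hqp hrk hrl hqk hql hpk hpl
      have h₂ := hs i r p hrq.symm hqp hrp hqk hql hrk hrl hpk hpl
      have h₃ := hs p r i hrp.symm (Ne.symm hqp) hrq hpk hpl hrk hrl hqk hql
      simp only [if_neg hil, if_neg hip, if_true]
      linarith
    · have h₁ := ht q i p (Ne.symm hiq) hqp hip hqk hql hik hil hpk hpl
      have h₂ := hs i q p hiq hip hqp hik hil hqk hql hpk hpl
      simp only [if_neg hil, if_neg hip, if_true]
      linarith
  · by_cases hip : i = p
    · subst hip
      simp only [if_neg hil, if_neg hjk, if_true]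
      by_cases hjq : j = q
      · subst hjq
        ring
      · have := hs i q j hqp.symm hij (Ne.symm hjq) hik hil hqk hql hjk hjl
        linarith
    · simp only [if_neg hil, if_neg hip, if_neg hjk]
      by_cases hjp : j = p
      · subst hjp
        ring
      · have := hs i p j hip hij (Ne.symm hjp) hik hil hpk hpl hjk hjl
        linarith

lemma IsTour.apply_apply_ne {n : ℕ} (hn : 3 ≤ n) {σ : Equiv.Perm (Fin n)} (h : IsTour σ)
    (i : Fin n) : σ (σ i) ≠ i := by
  intro hi
  have hmove : σ i ≠ i := by
    rw [← Equiv.Perm.mem_support, h.2]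
    exact mem_univ i
  have hpow : σ ^ 2 = 1 := h.1.pow_eq_one_iff.2 ⟨i, hmove, by simpa [pow_two] using hi⟩
  have hle := orderOf_le_of_pow_eq_one two_pos hpow
  rw [h.1.orderOf, h.2, card_univ, Fintype.card_fin] at hle
  omega

lemma linCost_eq_of_weak_sum {n : ℕ} (hn : 3 ≤ n) (k l : Fin n) (C : Fin n → Fin n → ℝ)
    (a b : Fin n → ℝ)
    (hC : ∀ i j : Fin n, i ≠ j → i ≠ k → j ≠ l → (i, j) ≠ (l, k) → C i j = a i + b j)
    (σ : Equiv.Perm (Fin n)) (hσ : IsTour σ) (hkl : σ k = l) :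
    linCost C σ = C k l + ∑ i ∈ Finset.univ.erase k, a i + ∑ j ∈ Finset.univ.erase l, b j := by
  have hb : ∑ i ∈ univ.erase k, b (σ i) = ∑ j ∈ univ.erase l, b j := by
    rw [sum_erase_eq_sub (mem_univ k), sum_erase_eq_sub (mem_univ l), Equiv.sum_comp σ b, hkl]
  have hsum : ∑ i ∈ univ.erase k, C i (σ i) = ∑ i ∈ univ.erase k, (a i + b (σ i)) := by
    refine sum_congr rfl fun i hi => hC i (σ i) ?_ (ne_of_mem_erase hi) ?_ ?_
    · have : i ∈ σ.support := hσ.2 ▸ mem_univ i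
      exact (Equiv.Perm.mem_support.1 this).symm
    · rw [← hkl]
      exact σ.injective.ne (ne_of_mem_erase hi)
    · intro h
      obtain ⟨hil, hik⟩ := Prod.mk.inj h
      exact hσ.apply_apply_ne hn k (by rw [hkl, ← hil, hik])
  rw [linCost, ← add_sum_erase _ _ (mem_univ k), hsum, sum_add_distrib, hb, hkl, add_assoc]

/-- characterization of the `(k,ℓ)`-constant value property, together with
the value of the common cost of tours through `(k,ℓ)`. -/
theorem klcvp_iff_weak_sum (n : ℕ) (hn : 5 ≤ n) (k l : Fin n) (hkl : k ≠ l)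
    (C : Fin n → Fin n → ℝ) :
    ((∃ K : ℝ, ∀ σ : Equiv.Perm (Fin n), IsTour σ → σ k = l → linCost C σ = K) ↔
      (∃ a b : Fin n → ℝ, ∀ i j : Fin n, i ≠ j → i ≠ k → j ≠ l → (i, j) ≠ (l, k) →
        C i j = a i + b j)) ∧
    (∀ a b : Fin n → ℝ,
      (∀ i j : Fin n, i ≠ j → i ≠ k → j ≠ l → (i, j) ≠ (l, k) → C i j = a i + b j) →
      ∀ σ : Equiv.Perm (Fin n), IsTour σ → σ k = l →
        linCost C σ = C k l + ∑ i ∈ Finset.univ.erase k, a i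
          + ∑ j ∈ Finset.univ.erase l, b j) := by
  refine ⟨⟨fun ⟨K, hK⟩ => exists_weak_sum_of_constant hn k l hkl C K hK, fun ⟨a, b, hC⟩ =>
    ⟨_, linCost_eq_of_weak_sum (by omega) k l C a b hC⟩⟩,
    linCost_eq_of_weak_sum (by omega) k l C⟩
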